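/- arXiv:1308.4030 — 2 statements merged into one kernel-verified Lean document; each statement's English description precedes it below -/
import Mathlib

section
/- Let B be a base of a proper cone Q in a finite-dimensional real vector space V. For every v ∈ V, ‖v‖_B = sup{⟨f,v⟩ : f ∈ V*, −e_B ≤_{Q*} f ≤_{Q*} e_B} = 2·sup{⟨f,v⟩ : f ∈ Q*, f ≤_{Q*} e_B} − ⟨e_B,v⟩. -/
open Set

variable {V : Type*} [NormedAddCommGroup V] [NormedSpace ℝ V] [FiniteDimensional ℝ V]

def IsConvexCone (Q : Set V) : Prop :=
  ∀ x ∈ Q, ∀ y ∈ Q, ∀ a b : ℝ, 0 ≤ a → 0 ≤ b → a • x + b • y ∈ Q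

def dualConeSet (Q : Set V) : Set (V →L[ℝ] ℝ) := {f | ∀ q ∈ Q, 0 ≤ f q}

def IsBase (Q B : Set V) : Prop :=
  B ⊆ Q ∧ IsCompact B ∧ Convex ℝ B ∧
    ∀ q ∈ Q, q ≠ 0 → ∃! p : ℝ × V, 0 < p.1 ∧ p.2 ∈ B ∧ q = p.1 • p.2

noncomputable def baseNorm (B : Set V) (v : V) : ℝ :=
  sInf {r | ∃ l m : ℝ, ∃ b₁ ∈ B, ∃ b₂ ∈ B, 0 ≤ l ∧ 0 ≤ m ∧ v = l • b₁ - m • b₂ ∧ r = l + m}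

variable {E : Type*} [NormedAddCommGroup E] [NormedSpace ℝ E]

protected lemma IsCompact.convexJoin {s t : Set E} (hs : IsCompact s) (ht : IsCompact t) :
    IsCompact (convexJoin ℝ s t) := by
  have himage : convexJoin ℝ s t = (fun p : ℝ × E × E => (1 - p.1) • p.2.1 + p.1 • p.2.2) ''
      (Icc (0 : ℝ) 1 ×ˢ s ×ˢ t) := by
    ext x
    simp only [mem_convexJoin, segment_eq_image, mem_image, Prod.exists, mem_prod]
    grind
  rw [himage]
  exact (isCompact_Icc.prod (hs.prod ht)).image (by fun_prop)

/-- A point outside the convex join of `B` and `-B` is separated from it by a functional which is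
bounded by one in absolute value on `B`. -/
lemma exists_abs_le_one_on_of_notMem_convexJoin {B : Set E} (hB : IsCompact B)
    (hconv : Convex ℝ B) (hne : B.Nonempty) {w : E} (hw : w ∉ convexJoin ℝ B (-B)) :
    ∃ f : E →L[ℝ] ℝ, (∀ b ∈ B, |f b| ≤ 1) ∧ 1 < f w := by
  obtain ⟨f, u, hfu, huw⟩ := geometric_hahn_banach_closed_point (hconv.convexJoin hconv.neg)
    (hB.convexJoin hB.neg).isClosed hw
  have hpos : ∀ b ∈ B, f b < u := fun b hb => hfu b (subset_convexJoin_left hne.neg hb)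
  have hneg : ∀ b ∈ B, -f b < u := fun b hb => by
    simpa using hfu (-b) (subset_convexJoin_right hne (by simpa using hb))
  obtain ⟨b₀, hb₀⟩ := hne
  have hu : 0 < u := by linarith [hpos b₀ hb₀, hneg b₀ hb₀]
  refine ⟨u⁻¹ • f, fun b hb => ?_, ?_⟩
  · have h : |f b| ≤ u := abs_le.2 ⟨by linarith [hneg b hb], (hpos b hb).le⟩
    rw [smul_apply, smul_eq_mul, abs_mul, abs_of_pos (inv_pos.2 hu),
      inv_mul_le_iff₀ hu]
    simpa using h
  · rw [smul_apply, smul_eq_mul, lt_inv_mul_iff₀ hu]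
    simpa using huw

lemma baseNorm_le {B : Set E} {b₁ b₂ : E} (hb₁ : b₁ ∈ B) (hb₂ : b₂ ∈ B) {l m : ℝ}
    (hl : 0 ≤ l) (hm : 0 ≤ m) : baseNorm B (l • b₁ - m • b₂) ≤ l + m := by
  refine csInf_le ⟨0, ?_⟩ ⟨l, m, b₁, hb₁, b₂, hb₂, hl, hm, rfl, rfl⟩
  rintro r ⟨l, m, b₁, -, b₂, -, hl, hm, -, rfl⟩
  exact add_nonneg hl hm

lemma baseNorm_smul_le_of_mem_convexJoin {B : Set E}
    {w : E} (hw : w ∈ convexJoin ℝ B (-B)) {c : ℝ} (hc : 0 ≤ c) :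
    baseNorm B (c • w) ≤ c := by
  rw [mem_convexJoin] at hw
  obtain ⟨b₁, hb₁, b₂, hb₂, s, t, hs, ht, hst, rfl⟩ := hw
  have h := baseNorm_le hb₁ (Set.mem_neg.1 hb₂) (mul_nonneg hc hs) (mul_nonneg hc ht)
  rw [← mul_add, hst, mul_one] at h
  simpa [smul_add, smul_smul] using h

/-- The base of a cone spans the cone by nonnegative multiples, with weight given by `e`. -/
lemma exists_eq_smul_of_mem_cone {Q B : Set E} (hBase : IsBase Q B) {e : E →L[ℝ] ℝ}
    (he : ∀ b ∈ B, e b = 1) (hne : B.Nonempty) {q : E} (hq : q ∈ Q) :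
    0 ≤ e q ∧ ∃ b ∈ B, q = e q • b := by
  by_cases h0 : q = 0
  · obtain ⟨b, hb⟩ := hne
    exact ⟨by simp [h0], b, hb, by simp [h0]⟩
  · obtain ⟨⟨t, b⟩, ⟨ht, hb, rfl⟩, -⟩ := hBase.2.2.2 q hq h0
    have h : e (t • b) = t := by simp [he b hb]
    exact ⟨h.symm ▸ ht.le, b, hb, by rw [h]⟩

lemma mem_dualConeSet_iff_of_isBase {Q B : Set E} (hBase : IsBase Q B) {f : E →L[ℝ] ℝ} :
    f ∈ dualConeSet Q ↔ ∀ b ∈ B, 0 ≤ f b := by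
  refine ⟨fun hf b hb => hf b (hBase.1 hb), fun hf q hq => ?_⟩
  by_cases h0 : q = 0
  · simp [h0]
  · obtain ⟨⟨t, b⟩, ⟨ht, hb, rfl⟩, -⟩ := hBase.2.2.2 q hq h0
    simpa using mul_nonneg ht.le (hf b hb)

/-- The base norm is the least upper bound of the functionals between `-e` and `e`. -/
lemma isLUB_baseNorm {Q B : Set E}
    (hgen : ∀ v : E, ∃ a ∈ Q, ∃ b ∈ Q, v = a - b) (hBase : IsBase Q B)
    {e : E →L[ℝ] ℝ} (he : ∀ b ∈ B, e b = 1) (v : E) :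
    IsLUB {r | ∃ f : E →L[ℝ] ℝ, (e - f) ∈ dualConeSet Q ∧ (e + f) ∈ dualConeSet Q ∧ r = f v}
      (baseNorm B v) := by
  simp only [mem_dualConeSet_iff_of_isBase hBase]
  rcases B.eq_empty_or_nonempty with hB | hne
  · have hQ : ∀ q ∈ Q, q = 0 := fun q hq => by
      by_contra h0
      obtain ⟨p, ⟨-, hp, -⟩, -⟩ := hBase.2.2.2 q hq h0
      simp [hB] at hp
    obtain ⟨a, ha, b, hb, rfl⟩ := hgen v
    simp [hQ a ha, hQ b hb, hB, baseNorm]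
  have hmem : ∀ f : E →L[ℝ] ℝ, (∀ b ∈ B, |f b| ≤ 1) →
      (∀ b ∈ B, 0 ≤ (e - f) b) ∧ ∀ b ∈ B, 0 ≤ (e + f) b := fun f hf => by
    constructor <;> intro b hb <;> have := abs_le.1 (hf b hb) <;> simp [he b hb] <;> linarith
  constructor
  · rintro r ⟨f, hf₁, hf₂, rfl⟩
    obtain ⟨a, ha, b, hb, hv⟩ := hgen v
    obtain ⟨hea, b₁, hb₁, ha'⟩ := exists_eq_smul_of_mem_cone hBase he hne ha
    obtain ⟨heb, b₂, hb₂, hb'⟩ := exists_eq_smul_of_mem_cone hBase he hne hb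
    refine le_csInf ⟨_, e a, e b, b₁, hb₁, b₂, hb₂, hea, heb, by rw [← ha', ← hb', hv], rfl⟩ ?_
    rintro r ⟨l, m, c₁, hc₁, c₂, hc₂, hl, hm, rfl, rfl⟩
    have h₁ := hf₁ c₁ hc₁
    have h₂ := hf₂ c₂ hc₂
    simp only [sub_apply, add_apply, he c₁ hc₁,
      he c₂ hc₂] at h₁ h₂
    simp only [map_sub, map_smul, smul_eq_mul]
    nlinarith
  · intro x hx
    have hx0 : 0 ≤ x := hx ⟨0, (hmem 0 (by simp)).1, (hmem 0 (by simp)).2, by simp⟩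
    refine le_of_forall_gt_imp_ge_of_dense fun c hc => ?_
    have hc0 : 0 < c := hx0.trans_lt hc
    by_contra! hlt
    have hw : c⁻¹ • v ∉ convexJoin ℝ B (-B) := fun hw => by
      have h := baseNorm_smul_le_of_mem_convexJoin hw hc0.le
      rw [smul_inv_smul₀ hc0.ne'] at h
      linarith
    obtain ⟨f, hf, hfw⟩ := exists_abs_le_one_on_of_notMem_convexJoin hBase.2.1 hBase.2.2.1 hne hw
    have hfx : f v ≤ x := hx ⟨f, (hmem f hf).1, (hmem f hf).2, rfl⟩
    rw [map_smul, smul_eq_mul, lt_inv_mul_iff₀ hc0] at hfw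
    linarith

/-- The change of variables `f ↦ (f + e) / 2` from `[-e, e]` to `[0, e]`. -/
lemma isLUB_dualCone_le_of_isLUB {Q : Set E} {e : E →L[ℝ] ℝ} {v : E} {N : ℝ}
    (h : IsLUB {r | ∃ f : E →L[ℝ] ℝ,
      (e - f) ∈ dualConeSet Q ∧ (e + f) ∈ dualConeSet Q ∧ r = f v} N) :
    IsLUB {r | ∃ f : E →L[ℝ] ℝ, f ∈ dualConeSet Q ∧ (e - f) ∈ dualConeSet Q ∧ r = f v}
      ((N + e v) / 2) := by
  constructor
  · rintro r ⟨f, hf₁, hf₂, rfl⟩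
    have := h.1 ⟨(2 : ℝ) • f - e, fun q hq => ?_, fun q hq => ?_, rfl⟩
    · simp only [sub_apply, smul_apply,
        smul_eq_mul] at this
      linarith
    · have := hf₂ q hq
      simp only [sub_apply, smul_apply,
        smul_eq_mul] at this ⊢
      linarith
    · have := hf₁ q hq
      simp only [add_apply, sub_apply,
        smul_apply, smul_eq_mul]
      linarith
  · intro x hx
    have hN : N ≤ 2 * x - e v := h.2 <| by
      rintro r ⟨f, hf₁, hf₂, rfl⟩
      have := hx ⟨(1 / 2 : ℝ) • (e + f), fun q hq => ?_, fun q hq => ?_, rfl⟩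
      · simp only [add_apply, smul_apply,
          smul_eq_mul] at this
        linarith
      · have := hf₂ q hq
        simp only [smul_apply, smul_eq_mul]
        linarith
      · have := hf₁ q hq
        simp only [add_apply, sub_apply,
          smul_apply, smul_eq_mul] at this ⊢
        linarith
    linarith

theorem stmt3 (Q B : Set V) (hconv : IsConvexCone Q) (hclosed : IsClosed Q)
    (hpointed : Q ∩ (-Q) ⊆ {0}) (hgen : ∀ v : V, ∃ a ∈ Q, ∃ b ∈ Q, v = a - b)
    (hBase : IsBase Q B)
    (e : V →L[ℝ] ℝ) (he : ∀ q ∈ Q, 0 ≤ e q) (heB : B = {q ∈ Q | e q = 1})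
    (v : V) :
    baseNorm B v =
      sSup {r | ∃ f : V →L[ℝ] ℝ, (e - f) ∈ dualConeSet Q ∧ (e + f) ∈ dualConeSet Q ∧ r = f v} ∧
    baseNorm B v =
      2 * sSup {r | ∃ f : V →L[ℝ] ℝ, f ∈ dualConeSet Q ∧ (e - f) ∈ dualConeSet Q ∧ r = f v}
        - e v := by
  have hLUB := isLUB_baseNorm hgen hBase (e := e) (fun b hb => by rw [heB] at hb; exact hb.2) v
  have hLUB' := isLUB_dualCone_le_of_isLUB hLUB
  refine ⟨(hLUB.csSup_eq hLUB.nonempty).symm, ?_⟩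
  rw [hLUB'.csSup_eq hLUB'.nonempty]
  ring
end

section
/- Let B be a faithful section of a base of B(H)^+ with dual section B̃. Then O_B = {x : ∃b ∈ B, −b ≤ x ≤ b} is the unit ball of a norm on the whole space B_h(H), and the unit ball of the dual norm (with respect to the trace duality ⟨x,y⟩ = Tr(xy)) is O_{B̃} = {y : ∃c ∈ B̃, −c ≤ y ≤ c}. -/
open Matrix ComplexOrder

variable {n : ℕ}

def Sb (b : Matrix (Fin n) (Fin n) ℂ) : Set (Matrix (Fin n) (Fin n) ℂ) :=
  {a | a.PosSemidef ∧ (a * b).trace = 1}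

def IsSection (B : Set (Matrix (Fin n) (Fin n) ℂ)) : Prop :=
  ∃ (L : Submodule ℝ (Matrix (Fin n) (Fin n) ℂ)) (b : Matrix (Fin n) (Fin n) ℂ),
    b.PosDef ∧ B = (L : Set (Matrix (Fin n) (Fin n) ℂ)) ∩ Sb b

def IsFaithfulSection (B : Set (Matrix (Fin n) (Fin n) ℂ)) : Prop :=
  IsSection B ∧ ∃ b ∈ B, b.PosDef

def dualSection (B : Set (Matrix (Fin n) (Fin n) ℂ)) : Set (Matrix (Fin n) (Fin n) ℂ) :=
  {c | c.PosSemidef ∧ ∀ b ∈ B, (b * c).trace = 1}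

def OB (B : Set (Matrix (Fin n) (Fin n) ℂ)) : Set (Matrix (Fin n) (Fin n) ℂ) :=
  {x | ∃ x₁ x₂ : Matrix (Fin n) (Fin n) ℂ,
    x₁.PosSemidef ∧ x₂.PosSemidef ∧ x₁ + x₂ ∈ B ∧ x = x₁ - x₂}

section TraceDuality

variable {m : Type*}

theorem posSemidef_real_smul {x : Matrix m m ℂ} (hx : x.PosSemidef) {r : ℝ} (hr : 0 ≤ r) :
    (r • x).PosSemidef := hx.smul hr

theorem isHermitian_add_conjTranspose (x : Matrix m m ℂ) : (x + xᴴ).IsHermitian := by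
  rw [Matrix.IsHermitian, Matrix.conjTranspose_add, Matrix.conjTranspose_conjTranspose, add_comm]

variable [Fintype m]

open scoped MatrixOrder in
theorem trace_mul_nonneg_of_posSemidef {x y : Matrix m m ℂ} (hx : x.PosSemidef)
    (hy : y.PosSemidef) : 0 ≤ (x * y).trace := by
  classical
  obtain ⟨a, rfl⟩ := CStarAlgebra.nonneg_iff_eq_star_mul_self.mp hx.nonneg
  rw [Matrix.star_eq_conjTranspose, Matrix.mul_assoc, Matrix.trace_mul_comm]
  exact (hy.mul_mul_conjTranspose_same a).trace_nonneg

theorem re_trace_mul_nonneg_of_posSemidef {x y : Matrix m m ℂ} (hx : x.PosSemidef)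
    (hy : y.PosSemidef) : 0 ≤ (x * y).trace.re :=
  (Complex.nonneg_iff.mp (trace_mul_nonneg_of_posSemidef hx hy)).1

theorem re_trace_conjTranspose_mul {y : Matrix m m ℂ} (hy : y.IsHermitian) (x : Matrix m m ℂ) :
    (xᴴ * y).trace.re = (x * y).trace.re := by
  have h : xᴴ * y = (y * x)ᴴ := by rw [Matrix.conjTranspose_mul, hy.eq]
  rw [h, Matrix.trace_conjTranspose, Matrix.trace_mul_comm]
  simp

theorem eq_zero_of_re_trace_mul_eq_zero {z : Matrix m m ℂ}
    (hz : ∀ x : Matrix m m ℂ, (x * z).trace.re = 0) : z = 0 := by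
  refine Matrix.trace_conjTranspose_mul_self_eq_zero_iff.mp (Complex.ext (hz zᴴ) ?_)
  exact (Complex.nonneg_iff.mp (Matrix.posSemidef_conjTranspose_mul_self z).trace_nonneg).2.symm

theorem re_trace_smul_mul (r : ℝ) (x y : Matrix m m ℂ) :
    ((r • x) * y).trace.re = r * (x * y).trace.re := by
  rw [Matrix.smul_mul, Matrix.trace_smul, Complex.smul_re, smul_eq_mul]

theorem re_trace_mul_smul (r : ℝ) (x y : Matrix m m ℂ) :
    (x * (r • y)).trace.re = r * (x * y).trace.re := by
  rw [Matrix.mul_smul, Matrix.trace_smul, Complex.smul_re, smul_eq_mul]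

theorem isClosed_setOf_posSemidef : IsClosed {x : Matrix m m ℂ | x.PosSemidef} := by
  simp only [Matrix.posSemidef_iff_dotProduct_mulVec, Set.ofPred_and, Set.ofPred_forall]
  refine IsClosed.inter (isClosed_eq (by fun_prop) continuous_id) (isClosed_iInter fun v => ?_)
  exact isClosed_le continuous_const (by fun_prop)

open scoped MatrixOrder Matrix.Norms.L2Operator in
/-- A positive definite matrix is an order unit for the Hermitian matrices. -/
theorem exists_posSemidef_smul_add_sub {b h : Matrix m m ℂ} (hb : b.PosDef)
    (hh : h.IsHermitian) :
    ∃ r : ℝ, 0 < r ∧ (r • b + h).PosSemidef ∧ (r • b - h).PosSemidef := by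
  classical
  rcases isEmpty_or_nonempty m with hm | hm
  · exact ⟨1, one_pos, by rw [Subsingleton.elim ((1 : ℝ) • b + h) 0]; exact .zero,
      by rw [Subsingleton.elim ((1 : ℝ) • b - h) 0]; exact .zero⟩
  obtain ⟨e, he, hle⟩ := (CFC.exists_pos_algebraMap_le_iff (A := Matrix m m ℂ)
    (a := b) hb.isHermitian).2 fun x hx => hb.isStrictlyPositive.spectrum_pos hx
  rw [Matrix.le_iff, Algebra.algebraMap_eq_smul_one] at hle
  have hsa : IsSelfAdjoint h := hh
  have h₁ := hsa.le_algebraMap_norm_self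
  have h₂ := hsa.neg_algebraMap_norm_le_self
  rw [Matrix.le_iff, Algebra.algebraMap_eq_smul_one] at h₁ h₂
  have hk : 0 < (‖h‖ + 1) / e := by positivity
  have hB := posSemidef_real_smul hle hk.le
  have h1 : (1 : Matrix m m ℂ).PosSemidef := .one
  have key : ((‖h‖ + 1) / e) • (b - e • (1 : Matrix m m ℂ)) =
      ((‖h‖ + 1) / e) • b - ‖h‖ • (1 : Matrix m m ℂ) - 1 := by
    rw [smul_sub, smul_smul, div_mul_cancel₀ _ he.ne', add_smul, one_smul, sub_sub]
  rw [key] at hB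
  refine ⟨_, hk, ?_, ?_⟩
  · convert (hB.add h₂).add h1 using 1
    abel
  · convert (hB.add h₁).add h1 using 1
    abel

/-- The slice `tr (x b) ≤ 1` of the positive cone is bounded in every direction. -/
theorem exists_abs_re_trace_mul_le {b : Matrix m m ℂ} (hb : b.PosDef) (h : Matrix m m ℂ) :
    ∃ C : ℝ, 0 < C ∧ ∀ x : Matrix m m ℂ, x.PosSemidef →
      |(x * h).trace.re| ≤ C * (x * b).trace.re := by
  obtain ⟨r, hr, h₁, h₂⟩ := exists_posSemidef_smul_add_sub hb (isHermitian_add_conjTranspose h)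
  refine ⟨r, hr, fun x hx => ?_⟩
  have k₁ := re_trace_mul_nonneg_of_posSemidef hx h₁
  have k₂ := re_trace_mul_nonneg_of_posSemidef hx h₂
  have k₃ := re_trace_mul_nonneg_of_posSemidef hx hb.posSemidef
  have k₄ : (x * hᴴ).trace.re = (x * h).trace.re := by
    rw [Matrix.trace_mul_comm, re_trace_conjTranspose_mul hx.isHermitian, Matrix.trace_mul_comm]
  simp only [Matrix.mul_add, Matrix.mul_sub, Matrix.trace_add, Matrix.trace_sub, Complex.add_re,
    Complex.sub_re, re_trace_mul_smul, k₄] at k₁ k₂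
  have := mul_nonneg hr.le k₃
  exact abs_le.mpr ⟨by linarith, by linarith⟩

theorem exists_isCompact_posSemidef_subset {b : Matrix m m ℂ} (hb : b.PosDef) :
    ∃ K : Set (Matrix m m ℂ), IsCompact K ∧
      ∀ x : Matrix m m ℂ, x.PosSemidef → (x * b).trace.re ≤ 1 → x ∈ K := by
  classical
  choose C hC hCx using fun h : Matrix m m ℂ => exists_abs_re_trace_mul_le hb h
  let R (i j : m) : ℝ := C (Matrix.single j i 1) + C (Matrix.single j i (-Complex.I))
  refine ⟨Set.pi Set.univ fun i => Set.pi Set.univ fun j => Metric.closedBall 0 (R i j),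
    isCompact_univ_pi fun i => isCompact_univ_pi fun j => isCompact_closedBall _ _,
    fun x hx hxb i _ j _ => ?_⟩
  have bd (h : Matrix m m ℂ) : |(x * h).trace.re| ≤ C h :=
    (hCx h x hx).trans (mul_le_of_le_one_right (hC h).le hxb)
  have h₁ := bd (Matrix.single j i 1)
  have h₂ := bd (Matrix.single j i (-Complex.I))
  rw [Matrix.trace_mul_single] at h₁ h₂
  rw [mem_closedBall_zero_iff]
  refine (Complex.norm_le_abs_re_add_abs_im _).trans (add_le_add ?_ ?_)
  · simpa using h₁
  · simpa using h₂

/-- Real functionals nonnegative on the positive cone (and vanishing on skew-Hermitian matrices)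
are given by the trace pairing with a positive semidefinite matrix. -/
theorem exists_posSemidef_re_trace_mul_eq (φ : Matrix m m ℂ →ₗ[ℝ] ℝ)
    (hφ : ∀ x : Matrix m m ℂ, (x + xᴴ).PosSemidef → 0 ≤ φ x) :
    ∃ d : Matrix m m ℂ, d.PosSemidef ∧ ∀ x, φ x = (x * d).trace.re := by
  classical
  have hskew (x : Matrix m m ℂ) : φ xᴴ = φ x := by
    have h₁ := hφ (x - xᴴ) (by
      convert Matrix.PosSemidef.zero using 1
      rw [Matrix.conjTranspose_sub, Matrix.conjTranspose_conjTranspose]; abel)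
    have h₂ := hφ (xᴴ - x) (by
      convert Matrix.PosSemidef.zero using 1
      rw [Matrix.conjTranspose_sub, Matrix.conjTranspose_conjTranspose]; abel)
    rw [map_sub] at h₁ h₂
    linarith
  let d : Matrix m m ℂ := Matrix.of fun j i =>
    ⟨φ (Matrix.single i j 1), -φ (Matrix.single i j Complex.I)⟩
  have hd (x : Matrix m m ℂ) : φ x = (x * d).trace.re := by
    induction x using Matrix.induction_on' with
    | h_zero => simp
    | h_add p q hp hq => simp [Matrix.add_mul, hp, hq]
    | h_std_basis i j z =>
      have hz : Matrix.single i j z =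
          z.re • Matrix.single i j (1 : ℂ) + z.im • Matrix.single i j Complex.I := by
        rw [Matrix.smul_single, Matrix.smul_single, ← Matrix.single_add]
        congr 1
        apply Complex.ext <;> simp
      rw [hz, map_add, map_smul, map_smul, ← hz, Matrix.trace_single_mul]
      simp [d]
  have hherm : d.IsHermitian := by
    have hI (i j : m) : (Matrix.single i j Complex.I)ᴴ = -Matrix.single j i Complex.I := by
      rw [Matrix.conjTranspose_single, Complex.star_def, Complex.conj_I, Matrix.single_neg]
    ext i j
    apply Complex.ext
    · simp only [d, Matrix.conjTranspose_apply, Matrix.of_apply, Complex.star_def, Complex.conj_re]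
      rw [← hskew, Matrix.conjTranspose_single, star_one]
    · simp only [d, Matrix.conjTranspose_apply, Matrix.of_apply, Complex.star_def, Complex.conj_im]
      rw [← hskew, hI, map_neg, neg_neg]
  refine ⟨d, .of_dotProduct_mulVec_nonneg hherm fun v => ?_, hd⟩
  have hv : (Matrix.vecMulVec v (star v)).PosSemidef := Matrix.posSemidef_vecMulVec_self_star v
  have h := hφ _ (hv.add hv.conjTranspose)
  rw [hd, Matrix.vecMulVec_mul, Matrix.trace_vecMulVec, dotProduct_comm,
    ← Matrix.dotProduct_mulVec] at h
  refine Complex.nonneg_iff.mpr ⟨h, ?_⟩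
  exact (hherm.im_star_dotProduct_mulVec_self v).symm

end TraceDuality

theorem convex_OB {B : Set (Matrix (Fin n) (Fin n) ℂ)} (hB : Convex ℝ B) : Convex ℝ (OB B) := by
  rintro _ ⟨x₁, x₂, hx₁, hx₂, hx, rfl⟩ _ ⟨y₁, y₂, hy₁, hy₂, hy, rfl⟩ s t hs ht hst
  refine ⟨s • x₁ + t • y₁, s • x₂ + t • y₂,
    (posSemidef_real_smul hx₁ hs).add (posSemidef_real_smul hy₁ ht),
    (posSemidef_real_smul hx₂ hs).add (posSemidef_real_smul hy₂ ht), ?_, by module⟩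
  convert hB hx hy hs ht hst using 1
  module

theorem neg_mem_OB {B : Set (Matrix (Fin n) (Fin n) ℂ)} {x : Matrix (Fin n) (Fin n) ℂ}
    (hx : x ∈ OB B) : -x ∈ OB B := by
  obtain ⟨x₁, x₂, hx₁, hx₂, hx, rfl⟩ := hx
  exact ⟨x₂, x₁, hx₂, hx₁, add_comm x₁ x₂ ▸ hx, neg_sub x₁ x₂⟩

theorem convex_Sb (b : Matrix (Fin n) (Fin n) ℂ) : Convex ℝ (Sb b) := by
  rintro x ⟨hx, hxb⟩ y ⟨hy, hyb⟩ s t hs ht hst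
  refine ⟨(posSemidef_real_smul hx hs).add (posSemidef_real_smul hy ht), ?_⟩
  rw [Matrix.add_mul, Matrix.smul_mul, Matrix.smul_mul, Matrix.trace_add, Matrix.trace_smul,
    Matrix.trace_smul, hxb, hyb, ← add_smul, hst, one_smul]

theorem isClosed_Sb (b : Matrix (Fin n) (Fin n) ℂ) : IsClosed (Sb b) :=
  isClosed_setOf_posSemidef.inter (isClosed_eq (by fun_prop) continuous_const)

theorem isCompact_OB {B : Set (Matrix (Fin n) (Fin n) ℂ)} (hB : IsClosed B)
    {b : Matrix (Fin n) (Fin n) ℂ} (hb : b.PosDef) (hBb : B ⊆ Sb b) : IsCompact (OB B) := by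
  obtain ⟨K, hK, hmem⟩ := exists_isCompact_posSemidef_subset hb
  let S : Set (Matrix (Fin n) (Fin n) ℂ × Matrix (Fin n) (Fin n) ℂ) :=
    {p | p.1.PosSemidef ∧ p.2.PosSemidef ∧ p.1 + p.2 ∈ B}
  have hS : IsClosed S :=
    (isClosed_setOf_posSemidef.preimage continuous_fst).inter
      ((isClosed_setOf_posSemidef.preimage continuous_snd).inter
        (hB.preimage (continuous_fst.add continuous_snd)))
  have hSK : S ⊆ K ×ˢ K := by
    rintro ⟨x₁, x₂⟩ ⟨h₁, h₂, h⟩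
    have htr := congrArg Complex.re (hBb h).2
    have k₁ := re_trace_mul_nonneg_of_posSemidef h₁ hb.posSemidef
    have k₂ := re_trace_mul_nonneg_of_posSemidef h₂ hb.posSemidef
    rw [Matrix.add_mul, Matrix.trace_add, Complex.add_re, Complex.one_re] at htr
    exact ⟨hmem _ h₁ (by linarith), hmem _ h₂ (by linarith)⟩
  convert ((hK.prod hK).of_isClosed_subset hS hSK).image
    (continuous_fst.sub continuous_snd) using 1
  ext x
  constructor
  · rintro ⟨x₁, x₂, h₁, h₂, h, rfl⟩
    exact ⟨(x₁, x₂), ⟨h₁, h₂, h⟩, rfl⟩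
  · rintro ⟨⟨x₁, x₂⟩, ⟨h₁, h₂, h⟩, rfl⟩
    exact ⟨x₁, x₂, h₁, h₂, h, rfl⟩

theorem exists_pos_smul_mem_OB {B : Set (Matrix (Fin n) (Fin n) ℂ)}
    {b x : Matrix (Fin n) (Fin n) ℂ} (hb : b ∈ B) (hbd : b.PosDef) (hx : x.IsHermitian) :
    ∃ t : ℝ, 0 < t ∧ t • x ∈ OB B := by
  obtain ⟨r, hr, h₁, h₂⟩ := exists_posSemidef_smul_add_sub hbd hx
  have hr' : 0 ≤ (2 * r)⁻¹ := by positivity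
  refine ⟨r⁻¹, by positivity, (2 * r)⁻¹ • (r • b + x), (2 * r)⁻¹ • (r • b - x),
    posSemidef_real_smul h₁ hr', posSemidef_real_smul h₂ hr', ?_, ?_⟩
  · convert hb using 1
    match_scalars <;> field_simp <;> norm_num
  · match_scalars <;> field_simp <;> norm_num

theorem re_trace_mul_le_one_of_mem_OB {B : Set (Matrix (Fin n) (Fin n) ℂ)}
    {x y : Matrix (Fin n) (Fin n) ℂ} (hx : x ∈ OB B) (hy : y ∈ OB (dualSection B)) :
    (x * y).trace.re ≤ 1 := by
  obtain ⟨x₁, x₂, hx₁, hx₂, hx, rfl⟩ := hx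
  obtain ⟨y₁, y₂, hy₁, hy₂, hy, rfl⟩ := hy
  have h := congrArg Complex.re (hy.2 _ hx)
  have h₁₂ := re_trace_mul_nonneg_of_posSemidef hx₁ hy₂
  have h₂₁ := re_trace_mul_nonneg_of_posSemidef hx₂ hy₁
  simp only [Matrix.add_mul, Matrix.sub_mul, Matrix.mul_add, Matrix.mul_sub, Matrix.trace_add,
    Matrix.trace_sub, Complex.add_re, Complex.sub_re, Complex.one_re] at h ⊢
  linarith

/-- The polar inequality, extended by homogeneity to the cone generated by the section. -/
theorem re_trace_sub_mul_le {L : Submodule ℝ (Matrix (Fin n) (Fin n) ℂ)}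
    {b y x₁ x₂ : Matrix (Fin n) (Fin n) ℂ} (hb : b.PosDef)
    (hy : ∀ x ∈ OB ((L : Set (Matrix (Fin n) (Fin n) ℂ)) ∩ Sb b), (x * y).trace.re ≤ 1)
    (h₁ : x₁.PosSemidef) (h₂ : x₂.PosSemidef) (hL : x₁ + x₂ ∈ L) :
    ((x₁ - x₂) * y).trace.re ≤ ((x₁ + x₂) * b).trace.re := by
  have k₁ := re_trace_mul_nonneg_of_posSemidef h₁ hb.posSemidef
  have k₂ := re_trace_mul_nonneg_of_posSemidef h₂ hb.posSemidef
  have hsum : ((x₁ + x₂) * b).trace.re = (x₁ * b).trace.re + (x₂ * b).trace.re := by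
    rw [Matrix.add_mul, Matrix.trace_add, Complex.add_re]
  obtain hs | hs := (hsum ▸ add_nonneg k₁ k₂ : 0 ≤ ((x₁ + x₂) * b).trace.re).eq_or_lt
  · obtain ⟨C, -, hC⟩ := exists_abs_re_trace_mul_le hb y
    have c₁ := hC _ h₁
    have c₂ := hC _ h₂
    rw [show (x₁ * b).trace.re = 0 by linarith, mul_zero] at c₁
    rw [show (x₂ * b).trace.re = 0 by linarith, mul_zero] at c₂
    rw [← hs, Matrix.sub_mul, Matrix.trace_sub, Complex.sub_re]
    linarith [(abs_le.mp c₁).2, (abs_le.mp c₂).1]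
  · set s := ((x₁ + x₂) * b).trace.re
    have him : ((x₁ + x₂) * b).trace = (s : ℂ) := Complex.ext rfl
      (Complex.nonneg_iff.mp (trace_mul_nonneg_of_posSemidef (h₁.add h₂) hb.posSemidef)).2.symm
    have hs' : 0 ≤ s⁻¹ := by positivity
    have h := hy (s⁻¹ • (x₁ - x₂)) ⟨s⁻¹ • x₁, s⁻¹ • x₂, posSemidef_real_smul h₁ hs',
      posSemidef_real_smul h₂ hs', ?_, smul_sub _ _ _⟩
    · rw [re_trace_smul_mul, inv_mul_le_iff₀ hs, mul_one] at h
      exact h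
    · rw [← smul_add]
      refine ⟨L.smul_mem _ hL, posSemidef_real_smul (h₁.add h₂) hs', ?_⟩
      rw [Matrix.smul_mul, Matrix.trace_smul, him, Complex.real_smul, ← Complex.ofReal_mul,
        inv_mul_cancel₀ hs.ne', Complex.ofReal_one]

/-- Twice the Hermitian part, as a real-linear map. -/
def addConjTranspose : Matrix (Fin n) (Fin n) ℂ →ₗ[ℝ] Matrix (Fin n) (Fin n) ℂ where
  toFun x := x + xᴴ
  map_add' x y := by rw [Matrix.conjTranspose_add]; abel
  map_smul' r x := by simp [Matrix.conjTranspose_smul]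

theorem addConjTranspose_apply (x : Matrix (Fin n) (Fin n) ℂ) : addConjTranspose x = x + xᴴ := rfl

theorem addConjTranspose_of_isHermitian {x : Matrix (Fin n) (Fin n) ℂ} (hx : x.IsHermitian) :
    addConjTranspose x = (2 : ℝ) • x := by
  rw [addConjTranspose_apply, hx.eq, two_smul]

/-- The real part of the trace pairing against a fixed matrix. -/
def reTraceMul (y : Matrix (Fin n) (Fin n) ℂ) : Matrix (Fin n) (Fin n) ℂ →ₗ[ℝ] ℝ where
  toFun x := (x * y).trace.re
  map_add' x z := by rw [Matrix.add_mul, Matrix.trace_add, Complex.add_re]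
  map_smul' r x := re_trace_smul_mul r x y

theorem reTraceMul_apply (x y : Matrix (Fin n) (Fin n) ℂ) :
    reTraceMul y x = (x * y).trace.re := rfl

theorem reTraceMul_addConjTranspose {y : Matrix (Fin n) (Fin n) ℂ} (hy : y.IsHermitian)
    (x : Matrix (Fin n) (Fin n) ℂ) : reTraceMul y (addConjTranspose x) = 2 * reTraceMul y x := by
  rw [addConjTranspose_apply, map_add, reTraceMul_apply xᴴ, re_trace_conjTranspose_mul hy,
    ← reTraceMul_apply, two_mul]

/-- Pairs of matrices whose Hermitian parts are positive semidefinite. -/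
def posPairCone (n : ℕ) :
    PointedCone ℝ (Matrix (Fin n) (Fin n) ℂ × Matrix (Fin n) (Fin n) ℂ) where
  carrier := {p | (addConjTranspose p.1).PosSemidef ∧ (addConjTranspose p.2).PosSemidef}
  add_mem' := by
    rintro p q ⟨hp₁, hp₂⟩ ⟨hq₁, hq₂⟩
    exact ⟨by simpa using hp₁.add hq₁, by simpa using hp₂.add hq₂⟩
  zero_mem' := by simp [Matrix.PosSemidef.zero]
  smul_mem' := by
    rintro c p ⟨hp₁, hp₂⟩
    constructor
    · have h : addConjTranspose (c • p).1 = (c : ℝ) • addConjTranspose p.1 :=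
        map_smul addConjTranspose (c : ℝ) p.1
      exact h ▸ posSemidef_real_smul hp₁ c.2
    · have h : addConjTranspose (c • p).2 = (c : ℝ) • addConjTranspose p.2 :=
        map_smul addConjTranspose (c : ℝ) p.2
      exact h ▸ posSemidef_real_smul hp₂ c.2

theorem mem_posPairCone {p : Matrix (Fin n) (Fin n) ℂ × Matrix (Fin n) (Fin n) ℂ} :
    p ∈ posPairCone n ↔
      (addConjTranspose p.1).PosSemidef ∧ (addConjTranspose p.2).PosSemidef := Iff.rfl

/-- Pairs of matrices such that the Hermitian part of the sum lies in `L`. -/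
noncomputable def sumSubmodule (L : Submodule ℝ (Matrix (Fin n) (Fin n) ℂ)) :
    Submodule ℝ (Matrix (Fin n) (Fin n) ℂ × Matrix (Fin n) (Fin n) ℂ) :=
  L.comap (addConjTranspose.coprod addConjTranspose)

theorem mem_sumSubmodule {L : Submodule ℝ (Matrix (Fin n) (Fin n) ℂ)}
    {p : Matrix (Fin n) (Fin n) ℂ × Matrix (Fin n) (Fin n) ℂ} :
    p ∈ sumSubmodule L ↔ addConjTranspose p.1 + addConjTranspose p.2 ∈ L := Iff.rfl

theorem exists_add_mem_posPairCone {L : Submodule ℝ (Matrix (Fin n) (Fin n) ℂ)}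
    {b : Matrix (Fin n) (Fin n) ℂ} (hb : b.PosDef) (hbL : b ∈ L)
    (p : Matrix (Fin n) (Fin n) ℂ × Matrix (Fin n) (Fin n) ℂ) :
    ∃ q ∈ sumSubmodule L, q + p ∈ posPairCone n := by
  obtain ⟨r₁, hr₁, h₁, -⟩ := exists_posSemidef_smul_add_sub hb (isHermitian_add_conjTranspose p.1)
  obtain ⟨r₂, hr₂, h₂, -⟩ := exists_posSemidef_smul_add_sub hb (isHermitian_add_conjTranspose p.2)
  have hb₂ := addConjTranspose_of_isHermitian hb.isHermitian
  refine ⟨(r₁ + r₂) • (b, b), Submodule.smul_mem _ _ ?_, ?_, ?_⟩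
  · rw [mem_sumSubmodule, hb₂]
    exact L.add_mem (L.smul_mem _ hbL) (L.smul_mem _ hbL)
  · convert h₁.add (posSemidef_real_smul hb.posSemidef (r := r₁ + 2 * r₂) (by positivity)) using 1
    simp only [Prod.fst_add, Prod.smul_fst, map_add, map_smul, hb₂, ← addConjTranspose_apply]
    module
  · convert h₂.add (posSemidef_real_smul hb.posSemidef (r := 2 * r₁ + r₂) (by positivity)) using 1
    simp only [Prod.snd_add, Prod.smul_snd, map_add, map_smul, hb₂, ← addConjTranspose_apply]
    module

theorem mem_OB_dualSection {L : Submodule ℝ (Matrix (Fin n) (Fin n) ℂ)}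
    {b b₀ y : Matrix (Fin n) (Fin n) ℂ} (hb : b.PosDef) (hb₀ : b₀.PosDef) (hb₀L : b₀ ∈ L)
    (hy : y.IsHermitian)
    (hyp : ∀ x ∈ OB ((L : Set (Matrix (Fin n) (Fin n) ℂ)) ∩ Sb b), (x * y).trace.re ≤ 1) :
    y ∈ OB (dualSection ((L : Set (Matrix (Fin n) (Fin n) ℂ)) ∩ Sb b)) := by
  let F : Matrix (Fin n) (Fin n) ℂ × Matrix (Fin n) (Fin n) ℂ →ₗ[ℝ] ℝ :=
    (reTraceMul b - reTraceMul y).coprod (reTraceMul b + reTraceMul y)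
  have hF (p : Matrix (Fin n) (Fin n) ℂ × Matrix (Fin n) (Fin n) ℂ) :
      F p = (reTraceMul b p.1 - reTraceMul y p.1) + (reTraceMul b p.2 + reTraceMul y p.2) := rfl
  obtain ⟨g, hgF, hg⟩ := riesz_extension (posPairCone n)
    ⟨sumSubmodule L, F.domRestrict (sumSubmodule L)⟩
    (by
      rintro ⟨p, hpL⟩ hp
      have h := re_trace_sub_mul_le hb hyp hp.1 hp.2 hpL
      rw [← reTraceMul_apply, ← reTraceMul_apply, map_sub, map_add,
        reTraceMul_addConjTranspose hy, reTraceMul_addConjTranspose hy,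
        reTraceMul_addConjTranspose hb.isHermitian,
        reTraceMul_addConjTranspose hb.isHermitian] at h
      change 0 ≤ F p
      rw [hF]
      linarith)
    (fun p => by
      obtain ⟨q, hq, hqp⟩ := exists_add_mem_posPairCone hb₀ hb₀L p
      exact ⟨⟨q, hq⟩, hqp⟩)
  replace hgF (p) (hp : p ∈ sumSubmodule L) : g p = F p := hgF ⟨p, hp⟩
  obtain ⟨d₁, hd₁, hgd₁⟩ := exists_posSemidef_re_trace_mul_eq (g ∘ₗ LinearMap.inl ℝ _ _)
    fun x hx => hg _ (mem_posPairCone.mpr ⟨hx, by simp [Matrix.PosSemidef.zero]⟩)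
  obtain ⟨d₂, hd₂, hgd₂⟩ := exists_posSemidef_re_trace_mul_eq (g ∘ₗ LinearMap.inr ℝ _ _)
    fun x hx => hg _ (mem_posPairCone.mpr ⟨by simp [Matrix.PosSemidef.zero], hx⟩)
  have hgd (x₁ x₂ : Matrix (Fin n) (Fin n) ℂ) :
      g (x₁, x₂) = (x₁ * d₁).trace.re + (x₂ * d₂).trace.re := by
    rw [← hgd₁, ← hgd₂, LinearMap.comp_apply, LinearMap.comp_apply, ← map_add]
    simp
  have hyd : d₁ - d₂ + (2 : ℝ) • y = 0 := eq_zero_of_re_trace_mul_eq_zero fun x => by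
    have h := hgF (x, -x) (by rw [mem_sumSubmodule, map_neg, add_neg_cancel]; exact L.zero_mem)
    rw [hgd, hF, map_neg, map_neg, reTraceMul_apply x y, Matrix.neg_mul, Matrix.trace_neg,
      Complex.neg_re] at h
    rw [Matrix.mul_add, Matrix.mul_sub, Matrix.trace_add, Matrix.trace_sub, Complex.add_re,
      Complex.sub_re, re_trace_mul_smul]
    linarith
  have hhalf : (0 : ℝ) ≤ 1 / 2 := by norm_num
  have hd₁' := posSemidef_real_smul hd₁ hhalf
  have hd₂' := posSemidef_real_smul hd₂ hhalf
  refine ⟨(1 / 2 : ℝ) • d₂, (1 / 2 : ℝ) • d₁, hd₂', hd₁', ⟨hd₂'.add hd₁', ?_⟩, ?_⟩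
  · rintro a ⟨haL, ha, hab⟩
    refine Complex.ext ?_
      (Complex.nonneg_iff.mp (trace_mul_nonneg_of_posSemidef ha (hd₂'.add hd₁'))).2.symm
    have h := hgF (a, a) (by
      rw [mem_sumSubmodule, addConjTranspose_of_isHermitian ha.isHermitian]
      exact L.add_mem (L.smul_mem _ haL) (L.smul_mem _ haL))
    rw [hgd, hF, reTraceMul_apply a b, hab, Complex.one_re] at h
    rw [Matrix.mul_add, Matrix.trace_add, Complex.add_re, re_trace_mul_smul, re_trace_mul_smul,
      Complex.one_re]
    linarith
  · linear_combination (norm := module) (1 / 2 : ℝ) • hyd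

/-- `O_B` is the unit ball of a norm on the Hermitian matrices (it is convex, symmetric,
closed, bounded and absorbing in `B_h(H)`), and its polar with respect to the trace duality,
within the Hermitian matrices, is `O_{B̃}`. -/
theorem stmt11 (B : Set (Matrix (Fin n) (Fin n) ℂ)) (hB : IsFaithfulSection B) :
    Convex ℝ (OB B) ∧
    (∀ x ∈ OB B, -x ∈ OB B) ∧
    IsClosed (OB B) ∧
    Bornology.IsVonNBounded ℝ (OB B) ∧
    (∀ x : Matrix (Fin n) (Fin n) ℂ, x.IsHermitian → ∃ t : ℝ, 0 < t ∧ t • x ∈ OB B) ∧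
    {y : Matrix (Fin n) (Fin n) ℂ | y.IsHermitian ∧ ∀ x ∈ OB B, ((x * y).trace).re ≤ 1} =
      OB (dualSection B) := by
  obtain ⟨⟨L, b, hb, rfl⟩, b₀, hb₀, hb₀d⟩ := hB
  have hK := isCompact_OB (L.closed_of_finiteDimensional.inter (isClosed_Sb b)) hb
    Set.inter_subset_right
  refine ⟨convex_OB (L.convex.inter (convex_Sb b)), fun x => neg_mem_OB, hK.isClosed,
    hK.isVonNBounded ℝ, fun x => exists_pos_smul_mem_OB hb₀ hb₀d, Set.Subset.antisymm ?_ ?_⟩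
  · exact fun y hy => mem_OB_dualSection hb hb₀d hb₀.1 hy.1 hy.2
  · intro y hy
    refine ⟨?_, fun x hx => re_trace_mul_le_one_of_mem_OB hx hy⟩
    obtain ⟨y₁, y₂, hy₁, hy₂, -, rfl⟩ := hy
    exact hy₁.isHermitian.sub hy₂.isHermitian
end
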